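/- Let (W,S) be a finite Coxeter system, t ∈ S, and I ⊆ S. Then for every b ∈ X_{I{t}} (minimal double coset representatives for W_I\W/W_{{t}}), |W(I,{t},b)| = |W({t},I,b^{-1})|. -/

import Mathlib

open scoped Classical

variable {B : Type*} {W : Type*} [Group W] {M : CoxeterMatrix B}

/-- The parabolic subgroup `W_I` generated by the simple reflections indexed by `I`. -/
def parabolic (cs : CoxeterSystem M W) (I : Set B) : Subgroup W :=
  Subgroup.closure (cs.simple '' I)

/-- `X_I`: minimal length coset representatives of `W / W_I`. -/
def minReps (cs : CoxeterSystem M W) (I : Set B) : Set W :=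
  {w : W | ∀ i ∈ I, cs.length w < cs.length (w * cs.simple i)}

/-- `I ∼_W J`: the subsets of simple reflections are conjugate under `W`. -/
def ConjSubsets (cs : CoxeterSystem M W) (I J : Set B) : Prop :=
  ∃ w : W, (fun x => w * x * w⁻¹) '' (cs.simple '' I) = cs.simple '' J

theorem conjSubsets_equivalence (cs : CoxeterSystem M W) : Equivalence (ConjSubsets cs) where
  refl I := ⟨1, by simp⟩
  symm := by
    rintro I J ⟨w, h⟩
    refine ⟨w⁻¹, ?_⟩
    rw [← h, Set.image_image]
    simp [mul_assoc]
  trans := by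
    rintro I J K ⟨w, h⟩ ⟨v, h'⟩
    refine ⟨v * w, ?_⟩
    rw [← h', ← h]
    simp [Set.image_image, mul_assoc]

/-- The setoid of Coxeter classes. -/
def coxSetoid (cs : CoxeterSystem M W) : Setoid (Set B) :=
  ⟨ConjSubsets cs, conjSubsets_equivalence cs⟩

/-- The set of Coxeter classes `Λ(W)`. -/
def CoxeterClass (cs : CoxeterSystem M W) := Quotient (coxSetoid cs)

/-- `C` is a conjugacy class of the parabolic subgroup `W_I`. -/
def IsConjClassOfParabolic (cs : CoxeterSystem M W) (I : Set B) (C : Set W) : Prop :=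
  ∃ v ∈ parabolic cs I, C = {x : W | ∃ u ∈ parabolic cs I, u * v * u⁻¹ = x}

/-- `C` is an `I`-cuspidal class: a conjugacy class of `W_I` meeting no proper
parabolic subgroup of `W_I`. -/
def IsCuspidalClass (cs : CoxeterSystem M W) (I : Set B) (C : Set W) : Prop :=
  IsConjClassOfParabolic cs I C ∧ ∀ K : Set B, K ⊂ I → C ∩ (parabolic cs K : Set W) = ∅

/-- `w` is an `I`-element: `C(w) ∩ W_I` is an `I`-cuspidal class. -/
def IsElementOf (cs : CoxeterSystem M W) (I : Set B) (w : W) : Prop :=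
  IsCuspidalClass cs I ({x : W | IsConj w x} ∩ (parabolic cs I : Set W))

/-- The λ-set `C(λ)` of the Coxeter class of `I`: the set of `λ(I)`-elements. -/
def lambdaSet (cs : CoxeterSystem M W) (I : Set B) : Set W :=
  {w : W | ∃ J : Set B, ConjSubsets cs I J ∧ IsElementOf cs J w}

/-- The λ-set of a Coxeter class. -/
def lambdaSetQ (cs : CoxeterSystem M W) (lam : CoxeterClass cs) : Set W :=
  {w : W | ∃ I : Set B, Quotient.mk (coxSetoid cs) I = lam ∧ IsElementOf cs I w}

/-- The induced character `1_{W_I}^W` of the trivial character of `W_I`,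
as a `ℚ`-valued function on `W`. -/
noncomputable def indTriv (cs : CoxeterSystem M W) (I : Set B) : W → ℚ :=
  fun w => (Nat.card {g : W | g ∈ minReps cs I ∧ g⁻¹ * w * g ∈ parabolic cs I} : ℚ)


/-- `X_{IJ} = X_I⁻¹ ∩ X_J`: the minimal length representatives of the double cosets
`W_I \\ W / W_J`. -/
def doubleReps (cs : CoxeterSystem M W) (I J : Set B) : Set W :=
  (minReps cs I)⁻¹ ∩ minReps cs J

/-- `W(I,J,b) = {w ∈ W | w^J b⁻¹ = (w b⁻¹)_I}`, expressed through the (unique) parabolic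
components `w = u·c` (`u ∈ X_J`, `c ∈ W_J`) and `w b⁻¹ = p·q` (`p ∈ X_I`, `q ∈ W_I`). -/
def Wset (cs : CoxeterSystem M W) (I J : Set B) (b : W) : Set W :=
  {w : W | ∃ u c p q : W,
    u ∈ minReps cs J ∧ c ∈ parabolic cs J ∧ w = u * c ∧
    p ∈ minReps cs I ∧ q ∈ parabolic cs I ∧ w * b⁻¹ = p * q ∧ u * b⁻¹ = q}

/-- The generator `s i` acts on `W × ℤ/2` by conjugation on the first coordinate, flipping the
second coordinate exactly over `s i`. -/
noncomputable def signedConj (cs : CoxeterSystem M W) (i : B) : Equiv.Perm (W × ZMod 2) :=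
  Function.Involutive.toPerm
    (fun p => (cs.simple i * p.1 * cs.simple i, p.2 + if p.1 = cs.simple i then 1 else 0)) (by
      rintro ⟨x, e⟩
      have h : cs.simple i * x * cs.simple i = cs.simple i ↔ x = cs.simple i := by
        constructor
        · intro h
          have := congrArg (fun z => cs.simple i * z * cs.simple i) h
          simpa [mul_assoc] using this
        · rintro rfl
          simp
      ext
      · simp [mul_assoc]
      · simp only [h]
        split_ifs
        · rw [add_assoc, CharTwo.add_self_eq_zero, add_zero]
        · simp)

theorem signedConj_apply (cs : CoxeterSystem M W) (i : B) (x : W) (e : ZMod 2) :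
    signedConj cs i (x, e) =
      (cs.simple i * x * cs.simple i, e + if x = cs.simple i then 1 else 0) := rfl

theorem signedConj_mul_pow_apply (cs : CoxeterSystem M W) (i j : B) (k : ℕ) (x : W)
    (e : ZMod 2) :
    ((signedConj cs i * signedConj cs j) ^ k) (x, e) =
      ((cs.simple i * cs.simple j) ^ k * x * ((cs.simple i * cs.simple j) ^ k)⁻¹,
        e + ∑ l ∈ Finset.range (2 * k),
          if x = (cs.simple j * cs.simple i) ^ l * cs.simple j then 1 else 0) := by
  induction k with
  | zero => simp
  | succ k ih =>
    have hinv : ((cs.simple i * cs.simple j) ^ k)⁻¹ = (cs.simple j * cs.simple i) ^ k := by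
      rw [← inv_pow]
      simp
    have hcomm : cs.simple j * (cs.simple i * cs.simple j) ^ k =
        (cs.simple j * cs.simple i) ^ k * cs.simple j := by
      exact (SemiconjBy.pow_right (by simp [SemiconjBy, mul_assoc]) k)
    have h1 : (cs.simple i * cs.simple j) ^ k * x * ((cs.simple i * cs.simple j) ^ k)⁻¹ =
        cs.simple j ↔ x = (cs.simple j * cs.simple i) ^ (2 * k) * cs.simple j := by
      rw [mul_inv_eq_iff_eq_mul, ← eq_inv_mul_iff_mul_eq, hinv, hcomm, two_mul, pow_add, mul_assoc]
    have h2 : cs.simple j * ((cs.simple i * cs.simple j) ^ k * x *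
        ((cs.simple i * cs.simple j) ^ k)⁻¹) * cs.simple j = cs.simple i ↔
        x = (cs.simple j * cs.simple i) ^ (2 * k + 1) * cs.simple j := by
      have h3 : (cs.simple j * cs.simple i) ^ (2 * k + 1) * cs.simple j =
          ((cs.simple i * cs.simple j) ^ k)⁻¹ *
            (cs.simple j * cs.simple i * cs.simple j * (cs.simple i * cs.simple j) ^ k) := by
        rw [mul_assoc _ (cs.simple j), hcomm, hinv, two_mul, add_assoc, pow_add,
          pow_succ' _ k]
        simp only [mul_assoc]
      rw [h3, eq_inv_mul_iff_mul_eq, ← mul_inv_eq_iff_eq_mul]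
      constructor
      · intro h
        have := congrArg (fun z => cs.simple j * z * cs.simple j) h
        simpa [mul_assoc] using this
      · intro h
        rw [h]
        simp [mul_assoc]
    rw [pow_succ', Equiv.Perm.mul_apply, ih, Equiv.Perm.mul_apply, signedConj_apply,
      signedConj_apply, mul_add, mul_one, Finset.sum_range_succ, Finset.sum_range_succ]
    ext
    · simp only [pow_succ', mul_inv_rev, cs.inv_simple, mul_assoc]
    · simp only [h1, h2, add_assoc]

theorem signedConj_isLiftable (cs : CoxeterSystem M W) : M.IsLiftable (signedConj cs) := by
  intro i j
  ext1 ⟨x, e⟩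
  rw [signedConj_mul_pow_apply, two_mul, Finset.sum_range_add]
  simp [pow_add, CharTwo.add_self_eq_zero]

/-- The parity of the number of times `x` occurs in the right inversion sequence of any word
for `w`. -/
noncomputable def inversionParity (cs : CoxeterSystem M W) (w x : W) : ZMod 2 :=
  (cs.lift ⟨signedConj cs, signedConj_isLiftable cs⟩ w (x, 0)).2

theorem lift_signedConj_apply (cs : CoxeterSystem M W) (w x : W) (e : ZMod 2) :
    cs.lift ⟨signedConj cs, signedConj_isLiftable cs⟩ w (x, e) =
      (w * x * w⁻¹, e + inversionParity cs w x) := by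
  unfold inversionParity
  induction w using cs.simple_induction_left generalizing x e with
  | one => simp
  | mul_simple_left w i ih =>
    rw [map_mul, Equiv.Perm.mul_apply, Equiv.Perm.mul_apply, ih, ih x 0,
      cs.lift_apply_simple (signedConj_isLiftable cs), signedConj_apply, signedConj_apply]
    ext
    · simp [mul_assoc]
    · simp [add_assoc]

theorem inversionParity_mul (cs : CoxeterSystem M W) (v w x : W) :
    inversionParity cs (v * w) x =
      inversionParity cs w x + inversionParity cs v (w * x * w⁻¹) := by
  conv_lhs => rw [inversionParity, map_mul, Equiv.Perm.mul_apply]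
  rw [lift_signedConj_apply, lift_signedConj_apply, zero_add]

theorem inversionParity_one (cs : CoxeterSystem M W) (x : W) : inversionParity cs 1 x = 0 := by
  simp [inversionParity]

theorem inversionParity_simple (cs : CoxeterSystem M W) (i : B) (x : W) :
    inversionParity cs (cs.simple i) x = if x = cs.simple i then 1 else 0 := by
  rw [inversionParity, cs.lift_apply_simple (signedConj_isLiftable cs), signedConj_apply, zero_add]

theorem inversionParity_inv (cs : CoxeterSystem M W) (w x : W) :
    inversionParity cs w⁻¹ x = inversionParity cs w (w⁻¹ * x * w) := by
  have h := inversionParity_mul cs w w⁻¹ x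
  rw [mul_inv_cancel, inversionParity_one, inv_inv] at h
  exact CharTwo.add_eq_zero.mp h.symm

theorem inversionParity_wordProd (cs : CoxeterSystem M W) (ω : List B) (x : W) :
    inversionParity cs (cs.wordProd ω) x = ((cs.rightInvSeq ω).count x : ZMod 2) := by
  induction ω with
  | nil => simp [inversionParity_one]
  | cons i ω ih =>
    have h : cs.wordProd ω * x * (cs.wordProd ω)⁻¹ = cs.simple i ↔
        (cs.wordProd ω)⁻¹ * cs.simple i * cs.wordProd ω = x := by
      rw [mul_inv_eq_iff_eq_mul, ← eq_inv_mul_iff_mul_eq, eq_comm, mul_assoc]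
    rw [cs.wordProd_cons, inversionParity_mul, ih, inversionParity_simple,
      CoxeterSystem.rightInvSeq, List.count_cons]
    simp only [h, beq_iff_eq]
    push_cast
    rfl

theorem mem_rightInvSeq_of_inversionParity_ne_zero (cs : CoxeterSystem M W) {ω : List B} {x : W}
    (h : inversionParity cs (cs.wordProd ω) x ≠ 0) : x ∈ cs.rightInvSeq ω := by
  rw [inversionParity_wordProd] at h
  by_contra hx
  exact h (by rw [List.count_eq_zero_of_not_mem hx, Nat.cast_zero])

/-- A reflection inverts exactly one element commuting with it: itself. -/
theorem inversionParity_of_commute (cs : CoxeterSystem M W) {r u : W} (hr : cs.IsReflection r)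
    (hu : r * u * r⁻¹ = u) : inversionParity cs r u = if u = r then 1 else 0 := by
  obtain ⟨v, i, rfl⟩ := hr
  have h1 : cs.simple i * (v⁻¹ * u * v) * (cs.simple i)⁻¹ = v⁻¹ * u * v := by
    conv_rhs => rw [← hu]
    simp [mul_assoc]
  have h2 : v⁻¹ * u * v = cs.simple i ↔ u = v * cs.simple i * v⁻¹ := by
    constructor
    · intro h
      rw [← h]
      group
    · rintro rfl
      group
  rw [inversionParity_mul, inversionParity_mul, inversionParity_inv, inv_inv, h1,
    inversionParity_simple, add_comm, add_assoc, CharTwo.add_self_eq_zero, add_zero]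
  simp only [h2]

theorem inversionParity_ne_zero_iff (cs : CoxeterSystem M W) {w t : W}
    (ht : cs.IsReflection t) : inversionParity cs w t ≠ 0 ↔ cs.length (w * t) < cs.length w := by
  have key : ∀ v : W, inversionParity cs v t ≠ 0 → cs.length (v * t) < cs.length v := by
    intro v hv
    obtain ⟨ω, hω, rfl⟩ := cs.exists_isReduced v
    exact (cs.isRightInversion_of_mem_rightInvSeq hω
      (mem_rightInvSeq_of_inversionParity_ne_zero cs hv)).2
  refine ⟨key w, fun h h0 => ?_⟩
  have h1 := key (w * t) (by
    rw [inversionParity_mul, inversionParity_of_commute cs ht (by group), mul_inv_cancel_right, h0]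
    simp)
  rw [mul_assoc, ht.mul_self, mul_one] at h1
  omega

theorem inversionParity_eq_zero_iff (cs : CoxeterSystem M W) {w t : W}
    (ht : cs.IsReflection t) : inversionParity cs w t = 0 ↔ cs.length w < cs.length (w * t) := by
  have h := inversionParity_ne_zero_iff cs (w := w) ht
  have h1 := ht.length_mul_left_ne w
  constructor
  · intro h0
    have := mt h.mpr (not_not.mpr h0)
    omega
  · intro h0
    by_contra h2
    have := h.mp h2
    omega

theorem mem_minReps_iff (cs : CoxeterSystem M W) {I : Set B} {w : W} :
    w ∈ minReps cs I ↔ ∀ i ∈ I, inversionParity cs w (cs.simple i) = 0 :=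
  forall₂_congr fun i _ => (inversionParity_eq_zero_iff cs (cs.isReflection_simple i)).symm

theorem mem_minReps_singleton_iff (cs : CoxeterSystem M W) {t : B} {w : W} :
    w ∈ minReps cs {t} ↔ inversionParity cs w (cs.simple t) = 0 := by
  simp [mem_minReps_iff]

theorem simple_mem_parabolic (cs : CoxeterSystem M W) {I : Set B} {i : B} (hi : i ∈ I) :
    cs.simple i ∈ parabolic cs I :=
  Subgroup.subset_closure ⟨i, hi, rfl⟩

theorem conj_mem_parabolic_iff (cs : CoxeterSystem M W) {I : Set B} {c x : W}
    (hc : c ∈ parabolic cs I) : c * x * c⁻¹ ∈ parabolic cs I ↔ x ∈ parabolic cs I := by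
  rw [Subgroup.mul_mem_cancel_right _ (inv_mem hc), Subgroup.mul_mem_cancel_left _ hc]

theorem mem_parabolic_singleton_iff (cs : CoxeterSystem M W) {t : B} {c : W} :
    c ∈ parabolic cs {t} ↔ c = 1 ∨ c = cs.simple t := by
  constructor
  · intro h
    induction h using Subgroup.closure_induction with
    | mem x hx => simp_all
    | one => simp
    | mul x y _ _ hx hy => rcases hx with rfl | rfl <;> rcases hy with rfl | rfl <;> simp
    | inv x _ hx => rcases hx with rfl | rfl <;> simp
  · rintro (rfl | rfl)
    · exact one_mem _
    · exact simple_mem_parabolic cs rfl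

theorem inversionParity_of_notMem_parabolic (cs : CoxeterSystem M W) {I : Set B} {c : W}
    (hc : c ∈ parabolic cs I) {x : W} (hx : x ∉ parabolic cs I) : inversionParity cs c x = 0 := by
  induction hc using Subgroup.closure_induction generalizing x with
  | mem y hy =>
    obtain ⟨i, hi, rfl⟩ := hy
    rw [inversionParity_simple, if_neg]
    rintro rfl
    exact hx (simple_mem_parabolic cs hi)
  | one => exact inversionParity_one cs x
  | mul y z hy hz ihy ihz =>
    rw [inversionParity_mul, ihz hx, ihy, zero_add]
    rwa [conj_mem_parabolic_iff cs hz]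
  | inv y hy ih =>
    rw [inversionParity_inv]
    refine ih ?_
    have := conj_mem_parabolic_iff cs (x := x) (inv_mem hy)
    rw [inv_inv] at this
    exact this.not.mpr hx

theorem exists_wordProd_eq_of_mem_parabolic (cs : CoxeterSystem M W) {I : Set B} {c : W}
    (hc : c ∈ parabolic cs I) : ∃ ω : List B, (∀ i ∈ ω, i ∈ I) ∧ cs.wordProd ω = c := by
  induction hc using Subgroup.closure_induction with
  | mem y hy =>
    obtain ⟨i, hi, rfl⟩ := hy
    exact ⟨[i], by simpa using hi, by simp⟩
  | one => exact ⟨[], by simp, by simp⟩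
  | mul y z _ _ ihy ihz =>
    obtain ⟨ω, hω, rfl⟩ := ihy
    obtain ⟨ξ, hξ, rfl⟩ := ihz
    refine ⟨ω ++ ξ, fun i hi => ?_, cs.wordProd_append ω ξ⟩
    exact (List.mem_append.mp hi).elim (hω i) (hξ i)
  | inv y _ ih =>
    obtain ⟨ω, hω, rfl⟩ := ih
    exact ⟨ω.reverse, fun i hi => hω i (List.mem_reverse.mp hi), cs.wordProd_reverse ω⟩

theorem exists_inversionParity_ne_zero_of_mem_parabolic (cs : CoxeterSystem M W) {I : Set B}
    {c : W} (hc : c ∈ parabolic cs I) (hc1 : c ≠ 1) :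
    ∃ i ∈ I, inversionParity cs c (cs.simple i) ≠ 0 := by
  have hex : ∃ n, ∃ ω : List B, (∀ i ∈ ω, i ∈ I) ∧ cs.wordProd ω = c ∧ ω.length = n := by
    obtain ⟨ω, h1, h2⟩ := exists_wordProd_eq_of_mem_parabolic cs hc
    exact ⟨_, ω, h1, h2, rfl⟩
  obtain ⟨ω, hω, hωc, hlen⟩ := Nat.find_spec hex
  rcases List.eq_nil_or_concat ω with rfl | ⟨ξ, i, rfl⟩
  · exact absurd (by simpa using hωc.symm) hc1
  have hξ : ∀ j ∈ ξ, j ∈ I := fun j hj => hω j (by simp [hj])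
  refine ⟨i, hω i (by simp), fun h0 => ?_⟩
  rw [← hωc, cs.wordProd_concat, inversionParity_mul,
    inversionParity_simple, if_pos rfl, mul_inv_cancel_right] at h0
  have hmem := mem_rightInvSeq_of_inversionParity_ne_zero cs (ω := ξ) (x := cs.simple i) (by
    intro h
    simp [h] at h0)
  obtain ⟨k, hk, hki⟩ := List.getElem_of_mem hmem
  have hdel := cs.wordProd_mul_getD_rightInvSeq ξ k
  rw [List.getD_eq_getElem _ _ hk, hki] at hdel
  rw [cs.length_rightInvSeq] at hk
  refine Nat.find_min hex (m := (ξ.eraseIdx k).length) ?_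
    ⟨ξ.eraseIdx k, fun j hj => hξ j (List.mem_of_mem_eraseIdx hj), ?_, rfl⟩
  · rw [← hlen, List.length_eraseIdx_of_lt hk, List.length_concat]
    omega
  · rw [← hdel, ← cs.wordProd_concat, hωc]

/-- A minimal coset representative for `W_I` inverts no reflection of `W_I`. -/
theorem inversionParity_of_mem_minReps (cs : CoxeterSystem M W) {I : Set B} {x u : W}
    (hx : x ∈ minReps cs I) (hu : cs.IsReflection u) (huI : u ∈ parabolic cs I) :
    inversionParity cs x u = 0 := by
  obtain ⟨c, hc⟩ := exists_minimal_of_wellFoundedLT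
    (fun n => ∃ c ∈ parabolic cs I, cs.length (x * c) = n) ⟨_, 1, one_mem _, rfl⟩
  obtain ⟨⟨c, hcI, rfl⟩, hmin⟩ := hc
  have hG : ∀ v, cs.IsReflection v → v ∈ parabolic cs I → inversionParity cs (x * c) v = 0 := by
    intro v hv hvI
    by_contra h
    have hlt := (inversionParity_ne_zero_iff cs hv).mp h
    have := hmin ⟨c * v, mul_mem hcI hvI, rfl⟩ (by rw [← mul_assoc]; exact hlt.le)
    rw [← mul_assoc] at this
    omega
  by_cases hc1 : c = 1
  · simpa [hc1] using hG u hu huI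
  obtain ⟨i, hi, hne⟩ := exists_inversionParity_ne_zero_of_mem_parabolic cs (inv_mem hcI)
    (inv_ne_one.mpr hc1)
  refine absurd ?_ hne
  have h := inversionParity_mul cs (x * c) c⁻¹ (cs.simple i)
  rwa [mul_inv_cancel_right, (mem_minReps_iff cs).mp hx i hi,
    hG _ ((cs.isReflection_simple i).conj _)
      ((conj_mem_parabolic_iff cs (inv_mem hcI)).mpr (simple_mem_parabolic cs hi)),
    add_zero, eq_comm] at h

theorem eq_one_of_mul_mem_minReps (cs : CoxeterSystem M W) {I : Set B} {x c : W}
    (hx : x ∈ minReps cs I) (hc : c ∈ parabolic cs I) (hxc : x * c ∈ minReps cs I) : c = 1 := by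
  by_contra hc1
  obtain ⟨i, hi, hne⟩ := exists_inversionParity_ne_zero_of_mem_parabolic cs hc hc1
  have h := (mem_minReps_iff cs).mp hxc i hi
  rw [inversionParity_mul, inversionParity_of_mem_minReps cs hx
    ((cs.isReflection_simple i).conj _)
    ((conj_mem_parabolic_iff cs hc).mpr (simple_mem_parabolic cs hi)), add_zero] at h
  exact hne h

theorem one_mem_minReps (cs : CoxeterSystem M W) (I : Set B) : (1 : W) ∈ minReps cs I :=
  (mem_minReps_iff cs).mpr fun _ _ => inversionParity_one cs _

/-- A double coset of `W_I` contains at most one minimal representative. -/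
theorem eq_of_mul_eq_mul_of_mem_doubleReps (cs : CoxeterSystem M W) {I : Set B} {x y : W}
    (hx : x ∈ doubleReps cs I I) (hy : y ∈ doubleReps cs I I) {c d : W}
    (hc : c ∈ parabolic cs I) (hd : d ∈ parabolic cs I) (h : y * c = d * x) : x = y := by
  induction hn : cs.length c using Nat.strong_induction_on generalizing c d with
  | _ n ih =>
    subst hn
    by_cases hc1 : c = 1
    · rw [hc1, mul_one] at h
      have hd1 := eq_one_of_mul_mem_minReps cs (Set.mem_inv.mp hx.1) (inv_mem hd)
        (by rw [← mul_inv_rev, ← h]; exact hy.1)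
      rw [h, inv_eq_one.mp hd1, one_mul]
    obtain ⟨i, hi, hne⟩ := exists_inversionParity_ne_zero_of_mem_parabolic cs hc hc1
    have hmem : x * cs.simple i * x⁻¹ ∈ parabolic cs I := by
      by_contra hnot
      have h1 := inversionParity_mul cs y c (cs.simple i)
      rw [inversionParity_of_mem_minReps cs hy.2 ((cs.isReflection_simple i).conj _)
        ((conj_mem_parabolic_iff cs hc).mpr (simple_mem_parabolic cs hi)), add_zero, h,
        inversionParity_mul, (mem_minReps_iff cs).mp hx.2 i hi,
        inversionParity_of_notMem_parabolic cs hd hnot, add_zero] at h1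
      exact hne h1.symm
    refine ih _ ((inversionParity_ne_zero_iff cs (cs.isReflection_simple i)).mp hne)
      (mul_mem hc (simple_mem_parabolic cs hi)) (mul_mem hd hmem) ?_ rfl
    rw [← mul_assoc, h]
    group

theorem mem_doubleReps_of_isReflection (cs : CoxeterSystem M W) {I : Set B} {r : W}
    (hr : cs.IsReflection r) (h : r ∈ minReps cs I) : r ∈ doubleReps cs I I :=
  ⟨by rwa [Set.mem_inv, hr.inv], h⟩

/-- The `W_I`-conjugates of a reflection outside `W_I` include a minimal coset
representative. -/
theorem exists_conj_mem_minReps (cs : CoxeterSystem M W) {I : Set B} {r : W}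
    (hr : cs.IsReflection r) (hrI : r ∉ parabolic cs I) :
    ∃ q ∈ parabolic cs I, q * r * q⁻¹ ∈ minReps cs I := by
  obtain ⟨_, ⟨q, hq, rfl⟩, hmin⟩ := exists_minimal_of_wellFoundedLT
    (fun n => ∃ q ∈ parabolic cs I, cs.length (q * r * q⁻¹) = n) ⟨_, 1, one_mem _, rfl⟩
  refine ⟨q, hq, (mem_minReps_iff cs).mpr fun i hi => ?_⟩
  by_contra hne
  have hs := simple_mem_parabolic cs hi
  have hr' := hr.conj q
  have hrI' : q * r * q⁻¹ ∉ parabolic cs I := by rwa [conj_mem_parabolic_iff cs hq]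
  have hle := hmin (y := cs.length (cs.simple i * (q * r * q⁻¹) * cs.simple i))
    ⟨cs.simple i * q, mul_mem hs hq, by simp [mul_assoc]⟩
  generalize q * r * q⁻¹ = r' at *
  have hcomm : r' * cs.simple i * r'⁻¹ ≠ cs.simple i := by
    intro h
    rw [inversionParity_of_commute cs hr' h, if_neg] at hne
    · exact hne rfl
    · rintro rfl
      exact hrI' hs
  have h1 := (inversionParity_ne_zero_iff cs (cs.isReflection_simple i)).mp hne
  have h2 := (inversionParity_ne_zero_iff cs (w := cs.simple i * r')
    (cs.isReflection_simple i)).mp (by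
      rwa [inversionParity_mul, inversionParity_simple, if_neg hcomm, add_zero])
  have h3 : cs.length (cs.simple i * r') = cs.length (r' * cs.simple i) := by
    rw [← cs.length_inv, mul_inv_rev, hr'.inv, cs.inv_simple]
  have := hle (by omega)
  omega

theorem ncard_conj_mem_minReps (cs : CoxeterSystem M W) {I : Set B} {r : W}
    (hr : cs.IsReflection r) (hrI : r ∉ parabolic cs I) :
    {q | q ∈ parabolic cs I ∧ q * r * q⁻¹ ∈ minReps cs I}.ncard =
      {c | c ∈ parabolic cs I ∧ c * r * c⁻¹ = r}.ncard := by
  obtain ⟨p, hp, hpr⟩ := exists_conj_mem_minReps cs hr hrI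
  rw [← Set.ncard_image_of_injective {c | c ∈ parabolic cs I ∧ c * r * c⁻¹ = r}
    (mul_right_injective p)]
  congr 1
  ext q
  constructor
  · rintro ⟨hq, hqr⟩
    refine ⟨p⁻¹ * q, ⟨mul_mem (inv_mem hp) hq, ?_⟩, mul_inv_cancel_left p q⟩
    have h := eq_of_mul_eq_mul_of_mem_doubleReps cs
      (mem_doubleReps_of_isReflection cs (hr.conj q) hqr)
      (mem_doubleReps_of_isReflection cs (hr.conj p) hpr)
      (mul_mem hp (inv_mem hq)) (mul_mem hp (inv_mem hq)) (by group)
    have h' : p⁻¹ * q * r * (p⁻¹ * q)⁻¹ = p⁻¹ * (q * r * q⁻¹) * p := by group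
    rw [h', h]
    group
  · rintro ⟨c, ⟨hc, hcr⟩, rfl⟩
    refine ⟨mul_mem hp hc, ?_⟩
    have h' : p * c * r * (p * c)⁻¹ = p * (c * r * c⁻¹) * p⁻¹ := by group
    show p * c * r * (p * c)⁻¹ ∈ _
    rwa [h', hcr]

theorem ncard_Wset_singleton_right [Finite W] (cs : CoxeterSystem M W) (t : B) (I : Set B) (b : W) :
    (Wset cs I {t} b).ncard =
      {q | q ∈ parabolic cs I ∧ q * b ∈ minReps cs {t}}.ncard +
      {q | q ∈ parabolic cs I ∧ q * b ∈ minReps cs {t} ∧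
        q * (b * cs.simple t * b⁻¹) * q⁻¹ ∈ minReps cs I}.ncard := by
  rw [← Set.ncard_image_of_injective {q | q ∈ parabolic cs I ∧ q * b ∈ minReps cs {t}}
      (mul_left_injective b),
    ← Set.ncard_image_of_injective {q | q ∈ parabolic cs I ∧ q * b ∈ minReps cs {t} ∧
        q * (b * cs.simple t * b⁻¹) * q⁻¹ ∈ minReps cs I}
      (mul_left_injective (b * cs.simple t)), ← Set.ncard_union_eq]
  · congr 1
    ext w
    constructor
    · rintro ⟨u, c, p, q, hu, hc, rfl, hp, hq, h, rfl⟩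
      rcases (mem_parabolic_singleton_iff cs).mp hc with rfl | rfl
      · exact Or.inl ⟨u * b⁻¹, ⟨hq, by simpa using hu⟩, by simp⟩
      · refine Or.inr ⟨u * b⁻¹, ⟨hq, by simpa using hu, ?_⟩, by simp⟩
        convert hp using 1
        rw [← mul_inv_eq_iff_eq_mul] at h
        rw [← h]
        group
    · rintro (⟨q, ⟨hq, hqb⟩, rfl⟩ | ⟨q, ⟨hq, hqb, hqr⟩, rfl⟩)
      · exact ⟨q * b, 1, 1, q, hqb, one_mem _, by simp, one_mem_minReps cs I, hq, by simp,
          by simp⟩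
      · exact ⟨q * b, cs.simple t, _, q, hqb, simple_mem_parabolic cs rfl,
          by simp [mul_assoc], hqr, hq, by group, by simp⟩
  · rw [Set.disjoint_left]
    rintro _ ⟨q, ⟨-, hq⟩, rfl⟩ ⟨p, ⟨-, hp, -⟩, h⟩
    have h1 : p * b * cs.simple t = q * b := by simpa [mul_assoc] using h
    have := eq_one_of_mul_mem_minReps cs hp (simple_mem_parabolic cs rfl) (h1 ▸ hq)
    have h2 := cs.length_simple t
    simp [this] at h2

theorem ncard_Wset_singleton_left [Finite W] (cs : CoxeterSystem M W) (t : B) (I : Set B) {b : W}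
    (hb : b⁻¹ ∈ minReps cs I) :
    (Wset cs {t} I b⁻¹).ncard =
      {c | c ∈ parabolic cs I ∧ b⁻¹ * c * b ∈ minReps cs {t}}.ncard +
      {c | c ∈ parabolic cs I ∧ cs.simple t * b⁻¹ ∈ minReps cs I ∧
        cs.simple t * (b⁻¹ * c * b) * cs.simple t ∈ minReps cs {t}}.ncard := by
  rw [← Set.ncard_image_of_injective {c | c ∈ parabolic cs I ∧ b⁻¹ * c * b ∈ minReps cs {t}}
      (mul_right_injective b⁻¹),
    ← Set.ncard_image_of_injective {c | c ∈ parabolic cs I ∧ cs.simple t * b⁻¹ ∈ minReps cs I ∧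
        cs.simple t * (b⁻¹ * c * b) * cs.simple t ∈ minReps cs {t}}
      (mul_right_injective (cs.simple t * b⁻¹)), ← Set.ncard_union_eq]
  · congr 1
    ext w
    constructor
    · rintro ⟨u, c, p, q, hu, hc, rfl, hp, hq, h, h'⟩
      rw [inv_inv] at h h'
      rcases (mem_parabolic_singleton_iff cs).mp hq with rfl | rfl
      · obtain rfl := eq_inv_of_mul_eq_one_left h'
        refine Or.inl ⟨c, ⟨hc, ?_⟩, rfl⟩
        rwa [h, mul_one]
      · obtain rfl := eq_mul_inv_of_mul_eq h'
        refine Or.inr ⟨c, ⟨hc, hu, ?_⟩, rfl⟩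
        have h2 : cs.simple t * (b⁻¹ * c * b) = p * cs.simple t := by
          rw [← h]
          group
        rwa [h2, cs.simple_mul_simple_cancel_right]
    · rintro (⟨c, ⟨hc, hcb⟩, rfl⟩ | ⟨c, ⟨hc, hu, hcb⟩, rfl⟩)
      · exact ⟨b⁻¹, c, _, 1, hb, hc, rfl, hcb, one_mem _, by simp, by simp⟩
      · exact ⟨_, c, _, cs.simple t, hu, hc, rfl, hcb, simple_mem_parabolic cs rfl,
          by simp [mul_assoc], by simp⟩
  · rw [Set.disjoint_left]
    rintro _ ⟨c, ⟨hc, -⟩, rfl⟩ ⟨d, ⟨hd, hu, -⟩, h⟩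
    have h1 : cs.simple t * b⁻¹ = b⁻¹ * (c * d⁻¹) := by
      rw [← mul_assoc, eq_mul_inv_iff_mul_eq]
      exact h
    have := eq_one_of_mul_mem_minReps cs hb (mul_mem hc (inv_mem hd)) (h1 ▸ hu)
    rw [this, mul_one, mul_eq_right] at h1
    have h2 := cs.length_simple t
    simp [h1] at h2

/-- For `t ∈ S`, `I ⊆ S` and every `b ∈ X_{I{t}}`,
`|W(I,{t},b)| = |W({t},I,b⁻¹)|`. -/
theorem statement18 [Fintype W] (cs : CoxeterSystem M W) (t : B) (I : Set B) :
    ∀ b ∈ doubleReps cs I ({t} : Set B),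
      Nat.card (Wset cs I ({t} : Set B) b) = Nat.card (Wset cs ({t} : Set B) I b⁻¹) := by
  intro b hb
  have hbI : b⁻¹ ∈ minReps cs I := hb.1
  have hbt := (mem_minReps_singleton_iff cs).mp hb.2
  have hr : cs.IsReflection (b * cs.simple t * b⁻¹) := (cs.isReflection_simple t).conj b
  rw [Nat.card_coe_set_eq, Nat.card_coe_set_eq, ncard_Wset_singleton_right,
    ncard_Wset_singleton_left cs t I hbI]
  have hbr : inversionParity cs b⁻¹ (b * cs.simple t * b⁻¹) = 0 := by
    rw [inversionParity_inv, ← hbt]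
    congr 1
    group
  have hqb : ∀ q, inversionParity cs (q * b) (cs.simple t) =
      inversionParity cs q (b * cs.simple t * b⁻¹) := fun q => by
    rw [inversionParity_mul, hbt, zero_add]
  simp only [mem_minReps_singleton_iff, hqb]
  have htb : cs.simple t * b⁻¹ = b⁻¹ * (b * cs.simple t * b⁻¹) := by group
  by_cases hrI : b * cs.simple t * b⁻¹ ∈ parabolic cs I
  · have hr1 : b * cs.simple t * b⁻¹ ≠ 1 := by
      intro h
      have := hr.odd_length
      simp [h] at this
    congr 1
    · congr 1
      ext c
      refine and_congr_right fun hc => ?_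
      rw [inversionParity_mul, inversionParity_of_mem_minReps cs hbI
        (hr.conj c) ((conj_mem_parabolic_iff cs hc).mpr hrI), add_zero]
    · rw [(Set.ncard_eq_zero (Set.toFinite _)).mpr, (Set.ncard_eq_zero (Set.toFinite _)).mpr]
      · refine Set.eq_empty_of_forall_notMem ?_
        rintro c ⟨-, h, -⟩
        exact hr1 (eq_one_of_mul_mem_minReps cs hbI hrI (htb ▸ h))
      · refine Set.eq_empty_of_forall_notMem ?_
        rintro q ⟨hq, -, h⟩
        have := eq_one_of_mul_mem_minReps cs (one_mem_minReps cs I)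
          ((conj_mem_parabolic_iff cs hq).mpr hrI) (by rwa [one_mul])
        exact hr1 (conj_eq_one_iff.mp this)
  · have htbI : cs.simple t * b⁻¹ ∈ minReps cs I := by
      refine (mem_minReps_iff cs).mpr fun i hi => ?_
      rw [inversionParity_mul, (mem_minReps_iff cs).mp hbI i hi, inversionParity_simple, if_neg,
        add_zero]
      intro h
      apply hrI
      rw [← h]
      simpa [mul_assoc] using simple_mem_parabolic cs hi
    have hcomm : ∀ c, b⁻¹ * c * b * cs.simple t * (b⁻¹ * c * b)⁻¹ = cs.simple t ↔
        c * (b * cs.simple t * b⁻¹) * c⁻¹ = b * cs.simple t * b⁻¹ := fun c => by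
      have h : b⁻¹ * c * b * cs.simple t * (b⁻¹ * c * b)⁻¹ =
          b⁻¹ * (c * (b * cs.simple t * b⁻¹) * c⁻¹) * b := by group
      rw [h, mul_assoc b⁻¹, inv_mul_eq_iff_eq_mul, ← eq_mul_inv_iff_mul_eq]
    have hconj : ∀ c, inversionParity cs (cs.simple t * (b⁻¹ * c * b) * cs.simple t)
        (cs.simple t) = 1 + (inversionParity cs (b⁻¹ * c) (b * cs.simple t * b⁻¹) +
          if c * (b * cs.simple t * b⁻¹) * c⁻¹ = b * cs.simple t * b⁻¹ then 1 else 0) :=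
      fun c => by
        rw [inversionParity_mul, inversionParity_simple, if_pos rfl, mul_inv_cancel_right,
          inversionParity_mul, hqb, inversionParity_simple]
        simp only [hcomm]
    have hfix : ∀ c ∈ parabolic cs I,
        c * (b * cs.simple t * b⁻¹) * c⁻¹ = b * cs.simple t * b⁻¹ →
          inversionParity cs (b⁻¹ * c) (b * cs.simple t * b⁻¹) = 0 := fun c hc h => by
      rw [inversionParity_mul, inversionParity_of_notMem_parabolic cs hc hrI, h, hbr, add_zero]
    have hpar : ∀ q ∈ parabolic cs I, inversionParity cs q (b * cs.simple t * b⁻¹) = 0 :=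
      fun q hq => inversionParity_of_notMem_parabolic cs hq hrI
    have hcount := ncard_conj_mem_minReps cs hr hrI
    simp only [hconj, htbI, true_and]
    generalize b * cs.simple t * b⁻¹ = r at *
    have hl1 : {q | q ∈ parabolic cs I ∧ inversionParity cs q r = 0} = (parabolic cs I : Set W) :=
      Set.ext fun q => and_iff_left_of_imp (hpar q)
    have hl2 : {q | q ∈ parabolic cs I ∧ inversionParity cs q r = 0 ∧
        q * r * q⁻¹ ∈ minReps cs I} =
        {q | q ∈ parabolic cs I ∧ q * r * q⁻¹ ∈ minReps cs I} :=
      Set.ext fun q => and_congr_right fun hq => and_iff_right (hpar q hq)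
    have hsplit : {c | c ∈ parabolic cs I ∧ 1 + (inversionParity cs (b⁻¹ * c) r +
        if c * r * c⁻¹ = r then 1 else 0) = 0} =
        ((parabolic cs I : Set W) \
          {c | c ∈ parabolic cs I ∧ inversionParity cs (b⁻¹ * c) r = 0}) ∪
        {c | c ∈ parabolic cs I ∧ c * r * c⁻¹ = r} := by
      ext c
      by_cases hc : c ∈ parabolic cs I
      · by_cases h : c * r * c⁻¹ = r
        · simp [hc, h, hfix c hc h, CharTwo.add_self_eq_zero]
        · have h01 : ∀ e : ZMod 2, 1 + e = 0 ↔ e ≠ 0 := by decide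
          simp [hc, h, h01]
      · simp [hc]
    have hsub : {c | c ∈ parabolic cs I ∧ inversionParity cs (b⁻¹ * c) r = 0} ⊆
        (parabolic cs I : Set W) := fun c hc => hc.1
    rw [hl1, hl2, hcount, hsplit, Set.ncard_union_eq, ← add_assoc,
      ← Set.ncard_sdiff_add_ncard_of_subset hsub, add_comm (Set.ncard (_ \ _))]
    rw [Set.disjoint_left]
    rintro c ⟨hc, hne⟩ ⟨-, h⟩
    exact hne ⟨hc, hfix c hc h⟩
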